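/- arXiv:2010.16054 — 8 statements merged into one kernel-verified Lean document; each statement's English description precedes it below -/
import Mathlib

section
/- Silverman–Toeplitz theorem: an infinite real matrix A = (a_{n,k}) is regular, i.e., for every convergent real sequence x the sequence Ax is well defined, convergent, and lim Ax = lim x, if and only if: (S1) sup_n ∑_k |a_{n,k}| < ∞; (S2) lim_{n→∞} a_{n,k} = 0 for each k; and (S3) lim_{n→∞} ∑_k a_{n,k} = 1. -/
open Filter Topology

/-- `x ∈ ℓ∞`: `x` is a bounded real sequence. -/
def Bdd (x : ℕ → ℝ) : Prop := ∃ C : ℝ, ∀ n, |x n| ≤ C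

/-- An admissible ideal on `ℕ`: a family of subsets of `ℕ` closed under taking
subsets and finite unions, containing every finite set, and not containing `ℕ`. -/
def IsAdmissibleIdeal (I : Set (Set ℕ)) : Prop :=
  (∀ A ∈ I, ∀ B ⊆ A, B ∈ I) ∧
  (∀ A ∈ I, ∀ B ∈ I, A ∪ B ∈ I) ∧
  (∀ A : Set ℕ, A.Finite → A ∈ I) ∧
  (Set.univ : Set ℕ) ∉ I

/-- `I`-convergence of the sequence `x` to `η`. -/
def IdealLim (I : Set (Set ℕ)) (x : ℕ → ℝ) (η : ℝ) : Prop :=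
  ∀ ε : ℝ, 0 < ε → {n : ℕ | ε < |x n - η|} ∈ I

/-- `(Ax)ₙ = ∑ₖ a n k * x k`. -/
noncomputable def matMul (a : ℕ → ℕ → ℝ) (x : ℕ → ℝ) : ℕ → ℝ :=
  fun n => ∑' k, a n k * x k

/-- Condition (T1): `sup_n ∑ₖ |a n k| < ∞`. -/
def CondT1 (a : ℕ → ℕ → ℝ) : Prop :=
  ∃ C : ℝ, ∀ n : ℕ, ∀ F : Finset ℕ, ∑ k ∈ F, |a n k| ≤ C

/-- Condition (T2): the rows of `a` are summable and `J-lim_n ∑ₖ a n k = 1`. -/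
def CondT2 (J : Set (Set ℕ)) (a : ℕ → ℕ → ℝ) : Prop :=
  (∀ n, Summable (a n)) ∧ IdealLim J (fun n => ∑' k, a n k) 1

/-- Condition (T3): `J-lim_n ∑_{k ∈ E} |a n k| = 0` for every `E ∈ I`. -/
def CondT3 (I J : Set (Set ℕ)) (a : ℕ → ℕ → ℝ) : Prop :=
  ∀ E ∈ I, IdealLim J (fun n => ∑' k, E.indicator (fun j => |a n j|) k) 0

/-- `A` is `(I, J)`-regular: `A` maps every bounded `I`-convergent sequence to a
(well-defined) bounded `J`-convergent sequence and preserves the ideal limits. -/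
def IJRegular (I J : Set (Set ℕ)) (a : ℕ → ℕ → ℝ) : Prop :=
  ∀ x : ℕ → ℝ, Bdd x → ∀ η : ℝ, IdealLim I x η →
    (∀ n, Summable fun k => a n k * x k) ∧ Bdd (matMul a x) ∧
      IdealLim J (matMul a x) η

/-- The ideal `Z` of sets of asymptotic density zero. -/
def densityZeroIdeal : Set (Set ℕ) :=
  {S : Set ℕ | Tendsto
    (fun n : ℕ => (∑ k ∈ Finset.Icc 1 n, S.indicator (fun _ => (1 : ℝ)) k) / n)
    atTop (𝓝 0)}

/-- A real sequence tending to zero, viewed as an element of `C₀(ℕ, ℝ)`. -/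
def nullSeqToC0 (x : ℕ → ℝ) (hx : Tendsto x atTop (𝓝 0)) : ZeroAtInftyContinuousMap ℕ ℝ where
  toFun := x
  continuous_toFun := continuous_of_discreteTopology
  zero_at_infty' := by
    rwa [cocompact_eq_cofinite, Nat.cofinite_eq_atTop]

theorem ZeroAtInftyContinuousMap.abs_apply_le (f : ZeroAtInftyContinuousMap ℕ ℝ) (k : ℕ) :
    |f k| ≤ ‖f‖ := by
  simpa using f.toBCF.norm_coe_le_norm k

theorem ZeroAtInftyContinuousMap.summable_mul {u : ℕ → ℝ} (hu : Summable u)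
    (f : ZeroAtInftyContinuousMap ℕ ℝ) : Summable fun k => u k * f k := by
  refine Summable.of_norm_bounded (hu.abs.mul_right ‖f‖) fun k => ?_
  rw [Real.norm_eq_abs, abs_mul]
  exact mul_le_mul_of_nonneg_left (f.abs_apply_le k) (abs_nonneg _)

/-- The continuous functional `f ↦ ∑ₖ u k * f k` on `C₀(ℕ, ℝ)` given by a summable sequence `u`. -/
noncomputable def summableFunctional (u : ℕ → ℝ) (hu : Summable u) :
    ZeroAtInftyContinuousMap ℕ ℝ →L[ℝ] ℝ :=
  LinearMap.mkContinuous
    { toFun := fun f => ∑' k, u k * f k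
      map_add' := fun f g => by
        simp only [ZeroAtInftyContinuousMap.add_apply, mul_add]
        exact (f.summable_mul hu).tsum_add (g.summable_mul hu)
      map_smul' := fun r f => by
        simp only [ZeroAtInftyContinuousMap.smul_apply, smul_eq_mul, RingHom.id_apply,
          mul_left_comm, tsum_mul_left] }
    (∑' k, |u k|) fun f => by
      rw [← tsum_mul_right]
      refine tsum_of_norm_bounded (hu.abs.mul_right ‖f‖).hasSum fun k => ?_
      rw [Real.norm_eq_abs, abs_mul]
      exact mul_le_mul_of_nonneg_left (f.abs_apply_le k) (abs_nonneg _)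

theorem summableFunctional_apply (u : ℕ → ℝ) (hu : Summable u)
    (f : ZeroAtInftyContinuousMap ℕ ℝ) : summableFunctional u hu f = ∑' k, u k * f k := rfl

theorem sum_abs_le_norm_summableFunctional (u : ℕ → ℝ) (hu : Summable u) (F : Finset ℕ) :
    ∑ k ∈ F, |u k| ≤ ‖summableFunctional u hu‖ := by
  set s : ℕ → ℝ := fun k => if k ∈ F then SignType.sign (u k) else 0 with hs
  have hs0 : Tendsto s atTop (𝓝 0) := by
    refine tendsto_const_nhds.congr' ?_
    rw [← Nat.cofinite_eq_atTop]
    filter_upwards [F.eventually_cofinite_notMem] with k hk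
    simp [hs, hk]
  have hs1 : ‖nullSeqToC0 s hs0‖ ≤ 1 := by
    rw [← ZeroAtInftyContinuousMap.norm_toBCF_eq_norm,
      BoundedContinuousFunction.norm_le zero_le_one]
    intro k
    change |s k| ≤ 1
    by_cases hk : k ∈ F
    · rcases lt_trichotomy (u k) 0 with h | h | h <;> simp [hs, hk, h]
    · simp [hs, hk]
  have hval : summableFunctional u hu (nullSeqToC0 s hs0) = ∑ k ∈ F, |u k| := by
    rw [summableFunctional_apply]
    change ∑' k, u k * s k = _
    rw [tsum_eq_sum (s := F) fun k hk => by simp [hs, hk]]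
    refine Finset.sum_congr rfl fun k hk => ?_
    simp [hs, hk, self_mul_sign]
  rw [← hval]
  exact (le_abs_self _).trans ((summableFunctional u hu).unit_le_opNorm _ hs1)

/-- A matrix with summable rows which maps null sequences to convergent sequences has uniformly
bounded absolute row sums. -/
theorem condT1_of_tendsto_matMul {a : ℕ → ℕ → ℝ} (ha : ∀ n, Summable (a n))
    (h : ∀ x : ℕ → ℝ, Tendsto x atTop (𝓝 0) → ∃ l, Tendsto (matMul a x) atTop (𝓝 l)) :
    CondT1 a := by
  obtain ⟨C, hC⟩ := banach_steinhaus (g := fun n => summableFunctional (a n) (ha n)) fun f => by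
    have hf : Tendsto f atTop (𝓝 0) := by
      simpa [cocompact_eq_cofinite, Nat.cofinite_eq_atTop] using f.zero_at_infty'
    obtain ⟨l, hl⟩ := h f hf
    obtain ⟨C, hC⟩ := hl.norm.bddAbove_range
    exact ⟨C, fun n => hC ⟨n, rfl⟩⟩
  exact ⟨C, fun n F => (sum_abs_le_norm_summableFunctional _ (ha n) F).trans (hC n)⟩

theorem summable_mul_of_tendsto {u x : ℕ → ℝ} {L : ℝ} (hu : Summable u)
    (hx : Tendsto x atTop (𝓝 L)) : Summable fun k => u k * x k := by
  obtain ⟨C, hC⟩ := hx.norm.bddAbove_range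
  refine Summable.of_norm_bounded (hu.abs.mul_right C) fun k => ?_
  rw [norm_mul]
  exact mul_le_mul_of_nonneg_left (hC ⟨k, rfl⟩) (abs_nonneg _)

theorem tendsto_matMul_zero {a : ℕ → ℕ → ℝ} (hT : CondT1 a)
    (hcol : ∀ k, Tendsto (fun n => a n k) atTop (𝓝 0)) (ha : ∀ n, Summable (a n))
    {y : ℕ → ℝ} (hy : Tendsto y atTop (𝓝 0)) : Tendsto (matMul a y) atTop (𝓝 0) := by
  obtain ⟨C, hC⟩ := hT
  have hC0 : 0 ≤ C := by simpa using hC 0 ∅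
  rw [Metric.tendsto_atTop']
  intro ε hε
  have hδ : 0 < ε / (2 * (C + 1)) := by positivity
  obtain ⟨N, hN⟩ := Metric.tendsto_atTop.1 hy _ hδ
  have hhead : Tendsto (fun n => ∑ k ∈ Finset.range N, a n k * y k) atTop (𝓝 0) := by
    simpa using tendsto_finsetSum (Finset.range N) fun k _ => (hcol k).mul_const (y k)
  obtain ⟨M, hM⟩ := Metric.tendsto_atTop.1 hhead (ε / 2) (half_pos hε)
  refine ⟨M, fun n hn => ?_⟩
  have hh := hM n hn.le
  rw [Real.dist_0_eq_abs] at hh ⊢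
  have hshift : Summable fun k => |a n (k + N)| := (summable_nat_add_iff N).2 (ha n).abs
  have htail : |∑' k, a n (k + N) * y (k + N)| ≤ C * (ε / (2 * (C + 1))) := by
    have hsum : ∑' k, |a n (k + N)| ≤ C := by
      refine hshift.tsum_le_of_sum_le fun F => ?_
      simpa using hC n (F.map (addRightEmbedding N))
    refine (tsum_of_norm_bounded (f := fun k => a n (k + N) * y (k + N))
      (hshift.mul_right (ε / (2 * (C + 1)))).hasSum fun k => ?_).trans ?_
    · rw [norm_mul]
      have := hN (k + N) (Nat.le_add_left _ _)
      rw [Real.dist_0_eq_abs] at this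
      exact mul_le_mul_of_nonneg_left this.le (abs_nonneg _)
    · rw [tsum_mul_right]
      exact mul_le_mul_of_nonneg_right hsum hδ.le
  have hlt : C * (ε / (2 * (C + 1))) < ε / 2 := by
    rw [mul_div_assoc', div_lt_div_iff₀ (by positivity) two_pos]
    nlinarith
  have hsplit := (summable_mul_of_tendsto (ha n) hy).sum_add_tsum_nat_add N
  calc |matMul a y n|
      = |∑ k ∈ Finset.range N, a n k * y k + ∑' k, a n (k + N) * y (k + N)| := by
        rw [hsplit, matMul]
    _ ≤ _ := abs_add_le _ _
    _ < ε := by linarith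

/-- **Silverman–Toeplitz theorem.** A matrix `A = (a n k)` is regular (for every
convergent real sequence `x`, `Ax` is well defined, convergent, and
`lim Ax = lim x`) iff (S1) `sup_n ∑ₖ |a n k| < ∞`, (S2) `lim_n a n k = 0` for
each `k`, and (S3) `lim_n ∑ₖ a n k = 1`. -/
theorem silverman_toeplitz (a : ℕ → ℕ → ℝ) :
    (∀ (x : ℕ → ℝ) (L : ℝ), Tendsto x atTop (𝓝 L) →
      (∀ n, Summable fun k => a n k * x k) ∧
        Tendsto (matMul a x) atTop (𝓝 L)) ↔
      (CondT1 a ∧ (∀ k : ℕ, Tendsto (fun n => a n k) atTop (𝓝 0)) ∧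
        ((∀ n, Summable (a n)) ∧ Tendsto (fun n => ∑' k, a n k) atTop (𝓝 1))) := by
  constructor
  · intro h
    obtain ⟨hsum, hlim⟩ := h (fun _ => 1) 1 tendsto_const_nhds
    simp only [mul_one] at hsum
    refine ⟨condT1_of_tendsto_matMul hsum fun x hx => ⟨0, (h x 0 hx).2⟩, fun k => ?_, hsum, ?_⟩
    · have hk : Tendsto (Pi.single k (1 : ℝ) : ℕ → ℝ) atTop (𝓝 0) := by
        refine tendsto_const_nhds.congr' ?_
        filter_upwards [eventually_ne_atTop k] with j hj
        simp [hj]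
      refine (h _ 0 hk).2.congr fun n => ?_
      rw [matMul, tsum_eq_single k fun j hj => by simp [hj]]
      simp
    · exact hlim.congr fun n => by simp only [matMul, mul_one]
  · rintro ⟨hT, hcol, ha, hrow⟩ x L hx
    refine ⟨fun n => summable_mul_of_tendsto (ha n) hx, ?_⟩
    have hy : Tendsto (fun k => x k - L) atTop (𝓝 0) := by
      simpa using hx.sub_const L
    have hlim := (tendsto_matMul_zero hT hcol ha hy).add (hrow.mul_const L)
    rw [zero_add, one_mul] at hlim
    refine hlim.congr fun n => ?_
    rw [matMul, matMul, ← tsum_mul_right,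
      ← (summable_mul_of_tendsto (ha n) hy).tsum_add ((ha n).mul_right L)]
    exact tsum_congr fun k => by ring
end

section
/- Let I, J be admissible ideals on ℕ and let A = (a_{n,k}) be an infinite real matrix satisfying: (T1) sup_n ∑_k |a_{n,k}| < ∞; (T2) J-lim_n ∑_k a_{n,k} = 1; and (T3) J-lim_n ∑_{k∈E} |a_{n,k}| = 0 for every E ∈ I. Then A is (I, J)-regular. -/
open Filter Topology

/-- A series `∑ a k * y k` with `y` bounded by `K`, and by `δ` off the set `E`, is at most
`K * ∑_{k ∈ E} |a k| + δ * ∑ |a k|`. -/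
theorem abs_tsum_mul_le_indicator_add {a y : ℕ → ℝ} {K δ : ℝ} {E : Set ℕ}
    (ha : Summable fun k => |a k|) (hK : ∀ k, |y k| ≤ K) (hδ : 0 ≤ δ)
    (hE : ∀ k ∉ E, |y k| ≤ δ) :
    |∑' k, a k * y k| ≤ K * (∑' k, E.indicator (fun j => |a j|) k) + δ * ∑' k, |a k| := by
  have hind : Summable (E.indicator fun j => |a j|) := ha.indicator E
  rw [← tsum_mul_left, ← tsum_mul_left,
    ← (hind.mul_left K).tsum_add (ha.mul_left δ), ← Real.norm_eq_abs]
  refine tsum_of_norm_bounded ((hind.mul_left K).add (ha.mul_left δ)).hasSum fun k => ?_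
  rw [Real.norm_eq_abs, abs_mul]
  by_cases hk : k ∈ E
  · rw [Set.indicator_of_mem hk]
    nlinarith [mul_le_mul_of_nonneg_left (hK k) (abs_nonneg (a k)),
      mul_nonneg hδ (abs_nonneg (a k))]
  · rw [Set.indicator_of_notMem hk]
    nlinarith [mul_le_mul_of_nonneg_left (hE k hk) (abs_nonneg (a k))]

/-- If a matrix `A` satisfies (T1), (T2) and (T3) for admissible ideals `I, J`
on `ℕ`, then `A` is `(I, J)`-regular. -/
theorem regular_of_T1_T2_T3 (I J : Set (Set ℕ))
    (hI : IsAdmissibleIdeal I) (hJ : IsAdmissibleIdeal J)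
    (a : ℕ → ℕ → ℝ) (h1 : CondT1 a) (h2 : CondT2 J a) (h3 : CondT3 I J a) :
    IJRegular I J a := by
  obtain ⟨C, hC⟩ := h1
  obtain ⟨hsum, hlim⟩ := h2
  have hC0 : 0 ≤ C := by simpa using hC 0 ∅
  have habs (n : ℕ) : Summable fun k => |a n k| := (hsum n).abs
  have htsum (n : ℕ) : ∑' k, |a n k| ≤ C := (habs n).tsum_le_of_sum_le (hC n)
  rintro x ⟨M, hM⟩ η hx
  have hM0 : 0 ≤ M := (abs_nonneg _).trans (hM 0)
  have hax (n : ℕ) : Summable fun k => a n k * x k := by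
    refine Summable.of_norm_bounded ((habs n).mul_right M) fun k => ?_
    rw [Real.norm_eq_abs, abs_mul]
    exact mul_le_mul_of_nonneg_left (hM k) (abs_nonneg _)
  refine ⟨hax, ⟨M * C, fun n => ?_⟩, fun ε hε => ?_⟩
  · have h := abs_tsum_mul_le_indicator_add (E := ∅) (habs n) hM hM0 fun k _ => hM k
    simp only [Set.indicator_empty, tsum_zero, mul_zero, zero_add] at h
    exact h.trans (mul_le_mul_of_nonneg_left (htsum n) hM0)
  · set K := M + |η| with hKdef
    have hη0 : 0 ≤ |η| := abs_nonneg η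
    have hK (k : ℕ) : |x k - η| ≤ K := (abs_sub _ _).trans (by linarith [hM k])
    have hK0 : 0 ≤ K := by positivity
    set δ := ε / (3 * (C + 1)) with hδdef
    have hδ : 0 < δ := by positivity
    set E := {k : ℕ | δ < |x k - η|} with hEdef
    have hEsmall := h3 E (hx δ hδ) (ε / (3 * (K + 1))) (by positivity)
    have hrow := hlim (ε / (3 * (|η| + 1))) (by positivity)
    refine hJ.1 _ (hJ.2.1 _ hEsmall _ hrow) _ fun n hn => ?_
    by_contra hnot
    simp only [Set.mem_union, Set.mem_ofPred_eq, not_or, not_lt, sub_zero] at hnot hn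
    obtain ⟨hn1, hn2⟩ := hnot
    have hdecomp : matMul a x n - η
        = (∑' k, a n k * (x k - η)) + η * ((∑' k, a n k) - 1) := by
      simp only [matMul, mul_sub]
      rw [(hax n).tsum_sub ((hsum n).mul_right η), tsum_mul_right]
      ring
    have hmain := abs_tsum_mul_le_indicator_add (E := E) (habs n) hK hδ.le
      fun k hk => not_lt.mp hk
    have scaled {t s : ℝ} (ht : 0 ≤ t) (hs : s ≤ ε / (3 * (t + 1))) : t * s ≤ ε / 3 := by
      refine (mul_le_mul_of_nonneg_left hs ht).trans ?_
      rw [← mul_div_assoc, div_le_div_iff₀ (by positivity) (by norm_num)]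
      nlinarith
    have hE3 := scaled hK0 ((le_abs_self _).trans hn1)
    have hη3 := scaled hη0 hn2
    have hC3 : δ * ∑' k, |a n k| ≤ ε / 3 :=
      (mul_le_mul_of_nonneg_left (htsum n) hδ.le).trans
        ((mul_comm δ C).trans_le (scaled hC0 le_rfl))
    rw [hdecomp] at hn
    have htri := abs_add_le (∑' k, a n k * (x k - η)) (η * ((∑' k, a n k) - 1))
    rw [abs_mul] at htri
    linarith
end

section
/- Let I, J be admissible ideals on ℕ. If an infinite real matrix A = (a_{n,k}) is (I, J)-regular, then A satisfies (T1) sup_n ∑_k |a_{n,k}| < ∞ and (T2) J-lim_n ∑_k a_{n,k} = 1. -/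
open Filter Topology

open scoped ZeroAtInfty

theorem Filter.Tendsto.idealLim {I : Set (Set ℕ)} (hI : IsAdmissibleIdeal I) {x : ℕ → ℝ} {η : ℝ}
    (hx : Tendsto x atTop (𝓝 η)) : IdealLim I x η := by
  intro ε hε
  refine hI.2.2.1 _ ?_
  obtain ⟨N, hN⟩ := Metric.tendsto_atTop.1 hx ε hε
  refine (Set.finite_Iio N).subset fun n hn => ?_
  by_contra h
  have := hN n (not_lt.1 h)
  rw [Real.dist_eq] at this
  exact lt_asymm this hn

theorem ZeroAtInftyContinuousMap.abs_apply_le_norm (f : C₀(ℕ, ℝ)) (k : ℕ) : |f k| ≤ ‖f‖ :=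
  f.toBCF.norm_coe_le_norm k

theorem summable_mul_zeroAtInfty {b : ℕ → ℝ} (hb : Summable fun k => |b k|) (f : C₀(ℕ, ℝ)) :
    Summable fun k => |b k * f k| := by
  refine Summable.of_nonneg_of_le (fun _ => abs_nonneg _) (fun k => ?_) (hb.mul_right ‖f‖)
  rw [abs_mul]
  exact mul_le_mul_of_nonneg_left (f.abs_apply_le_norm k) (abs_nonneg _)

theorem abs_tsum_mul_zeroAtInfty_le {b : ℕ → ℝ} (hb : Summable fun k => |b k|) (f : C₀(ℕ, ℝ)) :
    |∑' k, b k * f k| ≤ (∑' k, |b k|) * ‖f‖ := by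
  have hle : ∀ k, ‖b k * f k‖ ≤ |b k| * ‖f‖ := fun k => by
    rw [Real.norm_eq_abs, abs_mul]
    exact mul_le_mul_of_nonneg_left (f.abs_apply_le_norm k) (abs_nonneg _)
  rw [← tsum_mul_right]
  exact tsum_of_norm_bounded (hb.mul_right ‖f‖).hasSum hle

/-- The continuous functional `f ↦ ∑ₖ b k * f k` on `c₀` given by an absolutely summable `b`. -/
noncomputable def zeroAtInftyPairing (b : ℕ → ℝ) (hb : Summable fun k => |b k|) :
    C₀(ℕ, ℝ) →L[ℝ] ℝ :=
  LinearMap.mkContinuous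
    { toFun := fun f => ∑' k, b k * f k
      map_add' := fun f g => by
        have hf := (summable_mul_zeroAtInfty hb f).of_abs
        have hg := (summable_mul_zeroAtInfty hb g).of_abs
        simp only [ZeroAtInftyContinuousMap.add_apply, mul_add, hf.tsum_add hg]
      map_smul' := fun c f => by
        rw [RingHom.id_apply, smul_eq_mul, ← tsum_mul_left]
        exact tsum_congr fun k => by simp [mul_left_comm] }
    (∑' k, |b k|) (abs_tsum_mul_zeroAtInfty_le hb)

theorem zeroAtInftyPairing_apply (b : ℕ → ℝ) (hb : Summable fun k => |b k|) (f : C₀(ℕ, ℝ)) :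
    zeroAtInftyPairing b hb f = ∑' k, b k * f k := rfl

theorem sum_abs_le_norm_zeroAtInftyPairing (b : ℕ → ℝ) (hb : Summable fun k => |b k|)
    (F : Finset ℕ) : ∑ k ∈ F, |b k| ≤ ‖zeroAtInftyPairing b hb‖ := by
  let s : ℕ → ℝ := fun k => if k ∈ F then (SignType.sign (b k) : ℝ) else 0
  have hs : ∀ k, |s k| ≤ 1 := fun k => by
    by_cases hk : k ∈ F
    · rcases lt_trichotomy (b k) 0 with h | h | h <;> simp [s, hk, h]
    · simp [s, hk]
  have hs0 : Tendsto s (cocompact ℕ) (𝓝 0) := by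
    refine tendsto_const_nhds.congr' ?_
    rw [Filter.cocompact_eq_cofinite]
    filter_upwards [F.finite_toSet.compl_mem_cofinite] with k hk
    exact (if_neg hk).symm
  let f : C₀(ℕ, ℝ) := ⟨⟨s, continuous_of_discreteTopology⟩, hs0⟩
  have hf : ‖f‖ ≤ 1 := (BoundedContinuousFunction.norm_le zero_le_one).2 hs
  have hval : zeroAtInftyPairing b hb f = ∑ k ∈ F, |b k| := by
    rw [zeroAtInftyPairing_apply, tsum_eq_sum (s := F)]
    · refine Finset.sum_congr rfl fun k hk => ?_
      change b k * s k = _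
      simp [s, hk]
    · intro k hk
      change b k * s k = _
      simp [s, hk]
  calc ∑ k ∈ F, |b k| ≤ ‖zeroAtInftyPairing b hb f‖ := hval ▸ le_abs_self _
    _ ≤ ‖zeroAtInftyPairing b hb‖ * ‖f‖ := ContinuousLinearMap.le_opNorm _ _
    _ ≤ ‖zeroAtInftyPairing b hb‖ := mul_le_of_le_one_right (norm_nonneg (zeroAtInftyPairing b hb)) hf

/-- If a matrix `A` is `(I, J)`-regular for admissible ideals `I, J` on `ℕ`,
then `A` satisfies (T1) and (T2). -/
theorem T1_T2_of_regular (I J : Set (Set ℕ))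
    (hI : IsAdmissibleIdeal I) (hJ : IsAdmissibleIdeal J)
    (a : ℕ → ℕ → ℝ) (ha : IJRegular I J a) :
    CondT1 a ∧ CondT2 J a := by
  obtain ⟨hsum, -, hlim⟩ := ha (fun _ => 1) ⟨1, fun _ => by simp⟩ 1
    (tendsto_const_nhds.idealLim hI)
  simp only [mul_one] at hsum
  refine ⟨?_, hsum, ?_⟩
  swap
  · unfold matMul at hlim
    simpa only [mul_one] using hlim
  obtain ⟨C, hC⟩ := banach_steinhaus (g := fun n => zeroAtInftyPairing (a n) (hsum n).abs)
    fun f => by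
      have hf : Tendsto f atTop (𝓝 0) := by
        simpa [Filter.cocompact_eq_cofinite, Nat.cofinite_eq_atTop] using f.zero_at_infty'
      exact (ha f ⟨‖f‖, f.abs_apply_le_norm⟩ 0 (hf.idealLim hI)).2.1
  exact ⟨C, fun n F => (sum_abs_le_norm_zeroAtInftyPairing _ _ F).trans (hC n)⟩
end

section
/- Let I, J be admissible ideals on ℕ and let A = (a_{n,k}) be an infinite real matrix with a_{n,k} ≥ 0 for all n, k. Then A is (I, J)-regular if and only if A satisfies: (T1) sup_n ∑_k |a_{n,k}| < ∞; (T2) J-lim_n ∑_k a_{n,k} = 1; and (T3) J-lim_n ∑_{k∈E} |a_{n,k}| = 0 for every E ∈ I. -/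
open Filter Topology

/-- The indicator of a member of an ideal converges to `0` along that ideal. -/
theorem idealLim_indicator_zero {I : Set (Set ℕ)} (hI : IsAdmissibleIdeal I) {E : Set ℕ}
    (hE : E ∈ I) : IdealLim I (E.indicator fun _ => (1 : ℝ)) 0 := by
  refine fun ε hε => hI.1 E hE _ fun n hn => ?_
  by_contra h
  rw [Set.mem_ofPred_eq, Set.indicator_of_notMem h, sub_zero, abs_zero] at hn
  exact lt_asymm hε hn

/-- A constant sequence converges to its value along an ideal. -/
theorem idealLim_const {I : Set (Set ℕ)} (hI : IsAdmissibleIdeal I) (c : ℝ) :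
    IdealLim I (fun _ => c) c := by
  intro ε hε
  have h : {n : ℕ | ε < |c - c|} = ∅ := by ext; simp [hε.le]
  exact h ▸ hI.2.2.1 ∅ Set.finite_empty

theorem bdd_indicator_one (E : Set ℕ) : Bdd (E.indicator fun _ => (1 : ℝ)) := by
  refine ⟨1, fun n => ?_⟩
  by_cases h : n ∈ E <;> simp [h]

/-- A regular nonnegative matrix satisfies (T1), (T2) and (T3). -/
theorem IJRegular.condT {I J : Set (Set ℕ)} (hI : IsAdmissibleIdeal I) {a : ℕ → ℕ → ℝ}
    (ha : ∀ n k, 0 ≤ a n k) (h : IJRegular I J a) : CondT1 a ∧ CondT2 J a ∧ CondT3 I J a := by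
  obtain ⟨hs, ⟨C, hC⟩, hlim⟩ := h (fun _ => 1) ⟨1, by simp⟩ 1 (idealLim_const hI 1)
  have hA : matMul a (fun _ => 1) = fun n => ∑' k, a n k := by simp [matMul, funext_iff]
  rw [hA] at hC hlim
  simp only [mul_one] at hs
  refine ⟨⟨C, fun n F => ?_⟩, ⟨hs, hlim⟩, fun E hE => ?_⟩
  · simp only [abs_of_nonneg (ha _ _)]
    exact ((hs n).sum_le_tsum F fun k _ => ha n k).trans ((le_abs_self _).trans (hC n))
  · convert (h _ (bdd_indicator_one E) 0 (idealLim_indicator_zero hI hE)).2.2 using 1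
    funext n
    refine tsum_congr fun k => ?_
    by_cases hk : k ∈ E <;> simp [hk, abs_of_nonneg (ha n k)]

/-- A nonnegative weighted sum of a bounded sequence splits along a set outside which the sequence
is small. -/
theorem abs_tsum_mul_le {b y : ℕ → ℝ} (hb : ∀ k, 0 ≤ b k) (hs : Summable b) {K δ : ℝ}
    (hK : ∀ k, |y k| ≤ K) (hδ : 0 ≤ δ) {E : Set ℕ} (hE : ∀ k ∉ E, |y k| ≤ δ) :
    |∑' k, b k * y k| ≤ δ * ∑' k, b k + K * ∑' k, E.indicator b k := by
  have hsum : Summable fun k => δ * b k + K * E.indicator b k :=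
    (hs.mul_left δ).add ((hs.indicator E).mul_left K)
  have hle : ∀ k, ‖b k * y k‖ ≤ δ * b k + K * E.indicator b k := by
    intro k
    rw [Real.norm_eq_abs, abs_mul, abs_of_nonneg (hb k)]
    by_cases hk : k ∈ E
    · rw [Set.indicator_of_mem hk]
      nlinarith [mul_le_mul_of_nonneg_left (hK k) (hb k), mul_nonneg hδ (hb k)]
    · rw [Set.indicator_of_notMem hk]
      nlinarith [mul_le_mul_of_nonneg_left (hE k hk) (hb k)]
  have hbound := tsum_of_norm_bounded hsum.hasSum hle
  rwa [(hs.mul_left δ).tsum_add ((hs.indicator E).mul_left K), tsum_mul_left, tsum_mul_left,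
    Real.norm_eq_abs] at hbound

/-- A nonnegative matrix satisfying (T1), (T2) and (T3) is regular. -/
theorem ijRegular_of_condT {I J : Set (Set ℕ)} (hJ : IsAdmissibleIdeal J) {a : ℕ → ℕ → ℝ}
    (ha : ∀ n k, 0 ≤ a n k) (h1 : CondT1 a) (h2 : CondT2 J a) (h3 : CondT3 I J a) :
    IJRegular I J a := by
  rintro x ⟨M, hM⟩ η hx
  obtain ⟨C, hC⟩ := h1
  obtain ⟨hs, hlim⟩ := h2
  simp only [CondT3, abs_of_nonneg (ha _ _)] at h3
  simp only [abs_of_nonneg (ha _ _)] at hC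
  have hrow : ∀ n, ∑' k, a n k ≤ C := fun n => (hs n).tsum_le_of_sum_le (hC n)
  have hC0 : 0 ≤ C := by simpa using hC 0 ∅
  have hM0 : 0 ≤ M := (abs_nonneg _).trans (hM 0)
  have hsx : ∀ n, Summable fun k => a n k * x k := fun n =>
    .of_norm_bounded ((hs n).mul_right M) fun k => by
      rw [Real.norm_eq_abs, abs_mul, abs_of_nonneg (ha n k)]
      exact mul_le_mul_of_nonneg_left (hM k) (ha n k)
  refine ⟨hsx, ⟨M * C, fun n => ?_⟩, fun ε hε => ?_⟩
  · have h := abs_tsum_mul_le (ha n) (hs n) hM hM0 (E := ∅) fun k _ => hM k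
    simp only [Set.indicator_empty, tsum_zero, mul_zero, add_zero] at h
    exact h.trans (mul_le_mul_of_nonneg_left (hrow n) hM0)
  · set K := M + |η|
    have hK0 : 0 ≤ K := by positivity
    set δ := ε / (3 * (C + 1))
    have hδ : 0 < δ := by positivity
    set E := {k : ℕ | δ < |x k - η|}
    have hδC : δ * C ≤ ε / 3 := by
      have : δ * (C + 1) = ε / 3 := by simp only [δ]; field_simp
      linarith
    refine hJ.1 _ (hJ.2.1 _ (h3 E (hx δ hδ) (ε / (3 * (K + 1))) (by positivity))
      _ (hlim (ε / (3 * (|η| + 1))) (by positivity))) _ fun n hn => ?_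
    by_contra hnot
    simp only [Set.mem_union, Set.mem_ofPred_eq, not_or, not_lt, sub_zero] at hnot hn
    obtain ⟨hE, hsum⟩ := hnot
    have hdecomp : matMul a x n - η =
        ∑' k, a n k * (x k - η) + η * (∑' k, a n k - 1) := by
      simp only [matMul, mul_sub]
      rw [(hsx n).tsum_sub ((hs n).mul_right η), tsum_mul_right]
      ring
    have hmain := abs_tsum_mul_le (y := fun k => x k - η) (ha n) (hs n) (K := K)
      (fun k => (abs_sub _ _).trans (add_le_add_left (hM k) _)) hδ.le (E := E)
      fun k hk => not_lt.1 hk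
    have hKE : K * ∑' k, E.indicator (a n) k ≤ ε / 3 := by
      have h := (le_abs_self _).trans hE
      rw [le_div_iff₀ (by positivity)] at h
      have h0 : 0 ≤ ∑' k, E.indicator (a n) k :=
        tsum_nonneg fun k => Set.indicator_nonneg (fun j _ => ha n j) k
      change (∑' k, E.indicator (a n) k) * _ ≤ ε at h
      linarith
    have hη : |η| * |∑' k, a n k - 1| ≤ ε / 3 := by
      rw [le_div_iff₀ (by positivity)] at hsum
      linarith [abs_nonneg (∑' k, a n k - 1)]
    have htri := abs_add_le (∑' k, a n k * (x k - η)) (η * (∑' k, a n k - 1))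
    rw [← hdecomp, abs_mul] at htri
    linarith [mul_le_mul_of_nonneg_left (hrow n) hδ.le]

/-- For a nonnegative matrix `A` and admissible ideals `I, J` on `ℕ`, `A` is
`(I, J)`-regular iff it satisfies (T1), (T2) and (T3). -/
theorem nonneg_regular_iff (I J : Set (Set ℕ))
    (hI : IsAdmissibleIdeal I) (hJ : IsAdmissibleIdeal J)
    (a : ℕ → ℕ → ℝ) (ha : ∀ n k, 0 ≤ a n k) :
    IJRegular I J a ↔ (CondT1 a ∧ CondT2 J a ∧ CondT3 I J a) := by
  exact ⟨fun h => h.condT hI ha, fun ⟨h1, h2, h3⟩ => ijRegular_of_condT hJ ha h1 h2 h3⟩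
end

section
/- Let I be an admissible ideal on ℕ and let Fin be the ideal of finite subsets of ℕ. An infinite real matrix A = (a_{n,k}) is (I, Fin)-regular if and only if A satisfies: (T1) sup_n ∑_k |a_{n,k}| < ∞; (T2) lim_{n→∞} ∑_k a_{n,k} = 1; and (T3) lim_{n→∞} ∑_{k∈E} |a_{n,k}| = 0 for every E ∈ I. -/
open Filter Topology

/-- **Schur's lemma**: if the rows of `b` are absolutely summable and tend to `0` against every
sequence of signs and in every column, then they tend to `0` in `ℓ¹`. -/
theorem tendsto_tsum_abs_of_forall_sign {b : ℕ → ℕ → ℝ} (hb : ∀ n, Summable (b n))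
    (hcol : ∀ k, Tendsto (fun n => b n k) atTop (𝓝 0))
    (hsign : ∀ s : ℕ → Bool,
      Tendsto (fun n => ∑' k, b n k * if s k then (1 : ℝ) else -1) atTop (𝓝 0)) :
    Tendsto (fun n => ∑' k, |b n k|) atTop (𝓝 0) := by
  let σ : Bool → ℝ := fun c => if c then 1 else -1
  have hσ : ∀ c, |σ c| = 1 := by intro c; cases c <;> simp [σ]
  have hbs : ∀ n (s : ℕ → Bool), Summable fun k => b n k * σ (s k) := fun n s =>
    Summable.of_abs (by simpa [abs_mul, hσ] using (hb n).abs)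
  have hcont : ∀ n, Continuous fun s : ℕ → Bool => ∑' k, b n k * σ (s k) := fun n =>
    continuous_tsum
      (fun k => continuous_const.mul
        ((continuous_of_discreteTopology (f := σ)).comp (continuous_apply k)))
      (hb n).abs (fun k s => by simp [hσ])
  rw [Metric.tendsto_atTop]
  intro ε hε
  let S : ℕ → Set (ℕ → Bool) := fun N => {s | ∀ n ≥ N, |∑' k, b n k * σ (s k)| ≤ ε / 4}
  have hclosed : ∀ N, IsClosed (S N) := by
    intro N
    simp only [S, Set.ofPred_forall]
    exact isClosed_iInter fun n => isClosed_iInter fun _ =>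
      isClosed_le (hcont n).abs continuous_const
  have hunion : ⋃ N, S N = Set.univ := by
    refine Set.eq_univ_of_forall fun s => Set.mem_iUnion.2 ?_
    obtain ⟨N, hN⟩ := Metric.tendsto_atTop.1 (hsign s) (ε / 4) (by positivity)
    refine ⟨N, fun n hn => ?_⟩
    simpa [Real.dist_eq, σ] using (hN n hn).le
  obtain ⟨N, s, hs⟩ := nonempty_interior_of_iUnion_of_closed hclosed hunion
  obtain ⟨F, u, hu, hsub⟩ := isOpen_pi_iff.1 isOpen_interior s hs
  have hF : Tendsto (fun n => ∑ k ∈ F, |b n k|) atTop (𝓝 0) := by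
    simpa using tendsto_finsetSum F fun k _ => (hcol k).abs
  obtain ⟨M, hM⟩ := Metric.tendsto_atTop.1 hF (ε / 4) (by positivity)
  refine ⟨max N M, fun n hn => ?_⟩
  have hFn := hM n (le_of_max_le_right hn)
  rw [Real.dist_eq, sub_zero, abs_of_nonneg (Finset.sum_nonneg fun _ _ => abs_nonneg _)] at hFn
  let t : ℕ → Bool := fun k => if k ∈ F then s k else decide (0 ≤ b n k)
  have htS : t ∈ S N := interior_subset <| hsub fun k hk => by
    have hk' : k ∈ F := hk
    simpa [t, hk'] using (hu k hk').2
  have htn := htS n (le_of_max_le_left hn)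
  have hpoint : ∀ k, |b n k| ≤ b n k * σ (t k) + (F : Set ℕ).indicator (fun k => 2 * |b n k|) k := by
    intro k
    by_cases hk : k ∈ F
    · have h := neg_abs_le (b n k * σ (t k))
      rw [abs_mul, hσ, mul_one] at h
      simp only [Set.indicator, Finset.mem_coe, hk, if_true]
      linarith
    · rcases le_or_gt 0 (b n k) with h | h
      · simp [t, σ, hk, h, abs_of_nonneg h]
      · simp [t, σ, hk, not_le.2 h, abs_of_neg h]
  have hind : HasSum ((F : Set ℕ).indicator fun k => 2 * |b n k|) (∑ k ∈ F, 2 * |b n k|) := by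
    have h := hasSum_sum_of_ne_finset_zero
      (f := (F : Set ℕ).indicator fun k => 2 * |b n k|) (s := F) (L := .unconditional ℕ) (by
        intro k hk; simp [hk])
    rwa [Finset.sum_congr rfl (g := fun k => 2 * |b n k|) (by
      intro k hk; simp [hk])] at h
  have hle := hasSum_le hpoint (hb n).abs.hasSum ((hbs n t).hasSum.add hind)
  rw [← Finset.mul_sum] at hle
  rw [Real.dist_eq, sub_zero, abs_of_nonneg (tsum_nonneg fun _ => abs_nonneg _)]
  linarith [le_abs_self (∑' k, b n k * σ (t k))]

/-- If the rows of `a` are summable and `Ax` is bounded for every null sequence `x`, then the rows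
of `a` are uniformly bounded in `ℓ¹`. -/
theorem condT1_of_bounded_on_null {a : ℕ → ℕ → ℝ} (ha : ∀ n, Summable (a n))
    (h : ∀ x : ℕ → ℝ, Tendsto x atTop (𝓝 0) → ∃ C, ∀ n, |matMul a x n| ≤ C) :
    CondT1 a := by
  have hle : ∀ n (f : ZeroAtInftyContinuousMap ℕ ℝ) k, |a n k * f k| ≤ |a n k| * ‖f‖ := by
    intro n f k
    rw [abs_mul]
    exact mul_le_mul_of_nonneg_left (f.toBCF.norm_coe_le_norm k) (abs_nonneg _)
  have hsum : ∀ n (f : ZeroAtInftyContinuousMap ℕ ℝ), Summable fun k => a n k * f k := fun n f =>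
    Summable.of_norm_bounded ((ha n).abs.mul_right ‖f‖) (hle n f)
  let T : ℕ → ZeroAtInftyContinuousMap ℕ ℝ →L[ℝ] ℝ := fun n =>
    LinearMap.mkContinuous
      { toFun := fun f => ∑' k, a n k * f k
        map_add' := fun f g => by
          simp only [ZeroAtInftyContinuousMap.coe_add, Pi.add_apply, mul_add]
          exact (hsum n f).tsum_add (hsum n g)
        map_smul' := fun c f => by
          simp only [ZeroAtInftyContinuousMap.coe_smul, Pi.smul_apply, smul_eq_mul,
            RingHom.id_apply, ← tsum_mul_left]
          exact tsum_congr fun k => by ring }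
      (∑' k, |a n k|) fun f =>
        tsum_of_norm_bounded ((ha n).abs.hasSum.mul_right ‖f‖) (hle n f)
  have hT : ∀ n f, T n f = ∑' k, a n k * f k := fun _ _ => rfl
  obtain ⟨C, hC⟩ := banach_steinhaus (g := T) fun f => by
    have hf : Tendsto f atTop (𝓝 0) := by
      simpa [Nat.cofinite_eq_atTop] using f.zero_at_infty'
    exact h f hf
  refine ⟨C, fun n F => ?_⟩
  let x : ℕ → ℝ := fun k => if k ∈ F then (SignType.sign (a n k) : ℝ) else 0
  have hx0 : Tendsto x (cocompact ℕ) (𝓝 0) := by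
    rw [cocompact_eq_cofinite]
    refine tendsto_const_nhds.congr' ?_
    filter_upwards [F.finite_toSet.compl_mem_cofinite] with k hk
    have hk' : k ∉ F := hk
    simp [x, hk']
  let f : ZeroAtInftyContinuousMap ℕ ℝ := ⟨⟨x, continuous_of_discreteTopology⟩, hx0⟩
  have hf : ‖f‖ ≤ 1 := by
    rw [← ZeroAtInftyContinuousMap.norm_toBCF_eq_norm]
    refine (BoundedContinuousFunction.norm_le zero_le_one).2 fun k => ?_
    change |x k| ≤ 1
    by_cases hk : k ∈ F
    · rcases lt_trichotomy (a n k) 0 with h | h | h <;> simp [x, hk, h]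
    · simp [x, hk]
  have hTf : T n f = ∑ k ∈ F, |a n k| := by
    rw [hT, tsum_eq_sum (s := F)]
    · refine Finset.sum_congr rfl fun k hk => ?_
      change a n k * x k = _
      simp [x, hk, mul_comm (a n k), sign_mul_self]
    · intro k hk
      change a n k * x k = 0
      simp [x, hk]
  calc ∑ k ∈ F, |a n k| = T n f := hTf.symm
    _ ≤ ‖T n f‖ := le_abs_self _
    _ ≤ ‖T n‖ * ‖f‖ := (T n).le_opNorm f
    _ ≤ ‖T n‖ * 1 := mul_le_mul_of_nonneg_left hf (norm_nonneg (T n))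
    _ ≤ C := by simpa using hC n

/-- A matrix with `ℓ¹`-bounded rows whose mass on each set of `I` tends to `0` maps bounded
sequences with `I`-limit `0` to null sequences. -/
theorem tendsto_matMul_zero_s5 {I : Set (Set ℕ)} {a : ℕ → ℕ → ℝ} (h1 : CondT1 a)
    (ha : ∀ n, Summable (a n))
    (h3 : ∀ E ∈ I, Tendsto (fun n => ∑' k, E.indicator (fun j => |a n j|) k) atTop (𝓝 0))
    {y : ℕ → ℝ} (hy : Bdd y) (hlim : IdealLim I y 0) :
    Tendsto (matMul a y) atTop (𝓝 0) := by
  obtain ⟨C, hC⟩ := h1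
  obtain ⟨M, hM⟩ := hy
  have hC0 : 0 ≤ C := by simpa using hC 0 ∅
  rw [Metric.tendsto_atTop]
  intro δ hδ
  set ε := δ / (2 * (C + 1)) with hεdef
  have hε : 0 < ε := by positivity
  have hεC : ε * C < δ / 2 := by
    rw [hεdef, div_mul_eq_mul_div, div_lt_div_iff₀ (by positivity) two_pos]
    nlinarith
  set E := {n : ℕ | ε < |y n - 0|} with hE
  have hT3 : Tendsto (fun n => M * ∑' k, E.indicator (fun j => |a n j|) k) atTop (𝓝 0) := by
    simpa using (h3 E (hlim ε hε)).const_mul M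
  obtain ⟨N, hN⟩ := Metric.tendsto_atTop.1 hT3 (δ / 2) (by positivity)
  refine ⟨N, fun n hn => ?_⟩
  have hNn := hN n hn
  rw [Real.dist_eq, sub_zero] at hNn ⊢
  have hle : ∀ k, ‖a n k * y k‖ ≤ M * E.indicator (fun j => |a n j|) k + ε * |a n k| := by
    intro k
    rw [Real.norm_eq_abs, abs_mul]
    by_cases hk : k ∈ E
    · rw [Set.indicator_of_mem hk]
      nlinarith [mul_le_mul_of_nonneg_left (hM k) (abs_nonneg (a n k)),
        mul_nonneg hε.le (abs_nonneg (a n k))]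
    · rw [Set.indicator_of_notMem hk]
      have hk' : |y k| ≤ ε := by simpa [hE] using hk
      nlinarith [mul_le_mul_of_nonneg_left hk' (abs_nonneg (a n k))]
  have hrow : ∑' k, |a n k| ≤ C := (ha n).abs.tsum_le_of_sum_le (hC n)
  have hbound : |matMul a y n| ≤ _ := tsum_of_norm_bounded
    ((((ha n).abs.indicator E).hasSum.mul_left M).add ((ha n).abs.hasSum.mul_left ε)) hle
  nlinarith [le_abs_self (M * ∑' k, E.indicator (fun j => |a n j|) k),
    mul_le_mul_of_nonneg_left hrow hε.le]

/-- For an admissible ideal `I` on `ℕ`, a matrix `A` is `(I, Fin)`-regular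
(i.e., it maps bounded `I`-convergent sequences to convergent sequences and the
ordinary limit of `Ax` equals the `I`-limit of `x`) iff it satisfies (T1),
`lim_n ∑ₖ a n k = 1`, and `lim_n ∑_{k ∈ E} |a n k| = 0` for every `E ∈ I`. -/
theorem I_fin_regular_iff (I : Set (Set ℕ)) (hI : IsAdmissibleIdeal I)
    (a : ℕ → ℕ → ℝ) :
    (∀ x : ℕ → ℝ, Bdd x → ∀ η : ℝ, IdealLim I x η →
        (∀ n, Summable fun k => a n k * x k) ∧
          Tendsto (matMul a x) atTop (𝓝 η)) ↔
      (CondT1 a ∧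
        ((∀ n, Summable (a n)) ∧ Tendsto (fun n => ∑' k, a n k) atTop (𝓝 1)) ∧
        ∀ E ∈ I, Tendsto
          (fun n => ∑' k, E.indicator (fun j => |a n j|) k) atTop (𝓝 0)) := by
  constructor
  · intro h
    have hconst : IdealLim I (fun _ => 1) 1 := fun ε hε => hI.2.2.1 _ (by simp [hε.not_gt])
    obtain ⟨ha, hone⟩ := h (fun _ => 1) ⟨1, by simp⟩ 1 hconst
    simp only [mul_one] at ha
    have hfin : ∀ x : ℕ → ℝ, Bdd x → ∀ E ∈ I, Tendsto (matMul a (E.indicator x)) atTop (𝓝 0) := by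
      rintro x ⟨C, hC⟩ E hE
      refine (h _ ⟨C, fun n => ?_⟩ 0 fun ε hε => hI.1 E hE _ fun k hk => ?_).2
      · exact (norm_indicator_le_norm_self x n).trans (hC n)
      · by_contra hkE
        simp only [Set.mem_ofPred_eq, Set.indicator_of_notMem hkE, sub_zero, abs_zero] at hk
        exact hk.not_gt hε
    have hcol : ∀ k, Tendsto (fun n => a n k) atTop (𝓝 0) := by
      intro k
      refine (hfin (fun _ => 1) ⟨1, by simp⟩ {k} (hI.2.2.1 _ (Set.finite_singleton k))).congr
        fun n => ?_
      rw [matMul, tsum_eq_single k fun j hj => by simp [hj]]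
      simp
    refine ⟨condT1_of_bounded_on_null ha fun x hx => ?_, ⟨ha, ?_⟩, fun E hE => ?_⟩
    · have hbdd : Bdd x := by
        obtain ⟨C, hC⟩ := isBounded_iff_forall_norm_le.1 (Metric.isBounded_range_of_tendsto x hx)
        exact ⟨C, fun n => hC _ ⟨n, rfl⟩⟩
      have hlim : IdealLim I x 0 := by
        intro ε hε
        refine hI.2.2.1 _ ?_
        obtain ⟨N, hN⟩ := Metric.tendsto_atTop.1 hx ε hε
        refine (Set.finite_lt_nat N).subset fun n hn => ?_
        by_contra hnN
        exact lt_asymm hn (hN n (not_lt.1 hnN))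
      obtain ⟨C, hC⟩ := isBounded_iff_forall_norm_le.1
        (Metric.isBounded_range_of_tendsto _ (h x hbdd 0 hlim).2)
      exact ⟨C, fun n => hC _ ⟨n, rfl⟩⟩
    · exact hone.congr fun n => by simp [matMul]
    · have hschur := tendsto_tsum_abs_of_forall_sign (b := fun n => E.indicator (a n))
        (fun n => (ha n).indicator E) (fun k => ?_) fun s => ?_
      · refine hschur.congr fun n => tsum_congr fun k => ?_
        by_cases hk : k ∈ E <;> simp [hk]
      · by_cases hk : k ∈ E
        · simpa [hk] using hcol k
        · simp [hk]
      · refine (hfin (fun k => if s k then 1 else -1)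
          ⟨1, fun n => by dsimp only; split_ifs <;> simp⟩ E hE).congr fun n => tsum_congr fun k => ?_
        by_cases hk : k ∈ E <;> simp [hk]
  · rintro ⟨h1, ⟨ha, h2⟩, h3⟩ x ⟨C, hC⟩ η hη
    have hsum : ∀ n, Summable fun k => a n k * x k := fun n =>
      Summable.of_norm_bounded ((ha n).abs.mul_right C) fun k => by
        rw [Real.norm_eq_abs, abs_mul]
        exact mul_le_mul_of_nonneg_left (hC k) (abs_nonneg _)
    refine ⟨hsum, ?_⟩
    have hy : Bdd fun k => x k - η :=
      ⟨C + |η|, fun k => (abs_sub _ _).trans (by gcongr; exact hC k)⟩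
    have hlim : IdealLim I (fun k => x k - η) 0 := by simpa [IdealLim] using hη
    have hadd := (tendsto_matMul_zero_s5 h1 ha h3 hy hlim).add (h2.mul_const η)
    rw [zero_add, one_mul] at hadd
    refine hadd.congr fun n => ?_
    simp only [matMul, mul_sub]
    rw [(hsum n).tsum_sub ((ha n).mul_right η), tsum_mul_right, sub_add_cancel]
end

section
/- Let I be an admissible ideal on ℕ with Fin ⊊ I ⊆ Z, where Z is the ideal of asymptotic density zero sets. Then there exist an (I, Z)-regular infinite real matrix A = (a_{n,k}) and a set E ∈ I such that the sequence (∑_{k∈E} |a_{n,k}|)_n does not Z-converge to 0; that is, A is (I, Z)-regular but fails condition (T3). -/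
open Filter Topology

/-- The `j`-th binary digit of `n`, read as a sign. -/
def bitSign (j n : ℕ) : ℝ := if n.testBit j then -1 else 1

theorem abs_bitSign (j n : ℕ) : |bitSign j n| = 1 := by
  unfold bitSign; split <;> simp

theorem bitSign_two_pow_add {j m : ℕ} (h : j < m) (n : ℕ) :
    bitSign j (2 ^ m + n) = bitSign j n := by
  unfold bitSign; rw [Nat.testBit_two_pow_add_gt h]

theorem bitSign_of_lt {m n : ℕ} (h : n < 2 ^ m) : bitSign m n = 1 := by
  unfold bitSign; simp [Nat.testBit_lt_two_pow h]

theorem bitSign_two_pow_add_self {m n : ℕ} (h : n < 2 ^ m) : bitSign m (2 ^ m + n) = -1 := by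
  unfold bitSign; simp [Nat.testBit_two_pow_add_eq, Nat.testBit_lt_two_pow h]

/-- Orthogonality of the sign functions `bitSign j`, `j < m`, on `{0, …, 2 ^ m - 1}`. -/
theorem sum_sq_bitSign (y : ℕ → ℝ) (m : ℕ) :
    ∑ n ∈ Finset.range (2 ^ m), (∑ j ∈ Finset.range m, bitSign j n * y j) ^ 2
      = 2 ^ m * ∑ j ∈ Finset.range m, y j ^ 2 := by
  induction m with
  | zero => simp
  | succ m ih =>
    rw [pow_succ 2 m, mul_two, Finset.sum_range_add, ← Finset.sum_add_distrib]
    have key : ∀ n ∈ Finset.range (2 ^ m),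
        (∑ j ∈ Finset.range (m + 1), bitSign j n * y j) ^ 2
          + (∑ j ∈ Finset.range (m + 1), bitSign j (2 ^ m + n) * y j) ^ 2
        = 2 * (∑ j ∈ Finset.range m, bitSign j n * y j) ^ 2 + 2 * y m ^ 2 := by
      intro n hn
      have hn := Finset.mem_range.1 hn
      have hshift : ∑ j ∈ Finset.range m, bitSign j (2 ^ m + n) * y j
          = ∑ j ∈ Finset.range m, bitSign j n * y j :=
        Finset.sum_congr rfl fun j hj => by rw [bitSign_two_pow_add (Finset.mem_range.1 hj) n]
      rw [Finset.sum_range_succ, Finset.sum_range_succ, bitSign_of_lt hn,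
        bitSign_two_pow_add_self hn, hshift]
      ring
    rw [Finset.sum_congr rfl key, Finset.sum_add_distrib, ← Finset.mul_sum, ih,
      Finset.sum_range_succ]
    simp
    ring

/-- A normalized sum of the first `Nat.log 2 n` terms of `y`, signed by the digits of `n`. -/
noncomputable def signedMean (y : ℕ → ℝ) (n : ℕ) : ℝ :=
  (∑ j ∈ Finset.range (Nat.log 2 n), bitSign j n * y j) / (Nat.log 2 n + 1)

theorem abs_signedMean_le {y : ℕ → ℝ} {C : ℝ} (hy : ∀ n, |y n| ≤ C) (n : ℕ) :
    |signedMean y n| ≤ C := by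
  have hC : 0 ≤ C := (abs_nonneg _).trans (hy 0)
  unfold signedMean
  rw [abs_div, abs_of_pos (by positivity : (0 : ℝ) < Nat.log 2 n + 1),
    div_le_iff₀ (by positivity)]
  calc |∑ j ∈ Finset.range (Nat.log 2 n), bitSign j n * y j|
      ≤ ∑ j ∈ Finset.range (Nat.log 2 n), C :=
        (Finset.abs_sum_le_sum_abs _ _).trans
          (Finset.sum_le_sum fun j _ => by rw [abs_mul, abs_bitSign, one_mul]; exact hy j)
    _ ≤ C * (Nat.log 2 n + 1) := by simp; nlinarith

theorem sum_sq_signedMean_block_le {y : ℕ → ℝ} {C : ℝ} (hy : ∀ n, |y n| ≤ C) (m : ℕ) :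
    ∑ n ∈ Finset.range (2 ^ m), signedMean y (2 ^ m + n) ^ 2 ≤ 2 ^ m * C ^ 2 / (m + 1) := by
  have h1 : ∀ n ∈ Finset.range (2 ^ m), signedMean y (2 ^ m + n) ^ 2
      = (∑ j ∈ Finset.range m, bitSign j n * y j) ^ 2 / (m + 1) ^ 2 := by
    intro n hn
    have hn := Finset.mem_range.1 hn
    have hlog : Nat.log 2 (2 ^ m + n) = m :=
      Nat.log_eq_of_pow_le_of_lt_pow (by omega) (by rw [pow_succ]; omega)
    unfold signedMean
    rw [hlog, div_pow, Finset.sum_congr rfl fun j hj => by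
      rw [bitSign_two_pow_add (Finset.mem_range.1 hj) n]]
  have h2 : ∑ j ∈ Finset.range m, y j ^ 2 ≤ m * C ^ 2 := by
    calc ∑ j ∈ Finset.range m, y j ^ 2 ≤ ∑ j ∈ Finset.range m, C ^ 2 :=
          Finset.sum_le_sum fun j _ => sq_le_sq' (abs_le.1 (hy j)).1 (abs_le.1 (hy j)).2
      _ = m * C ^ 2 := by simp
  rw [Finset.sum_congr rfl h1, ← Finset.sum_div, sum_sq_bitSign,
    div_le_div_iff₀ (by positivity) (by positivity)]
  have h3 : (∑ j ∈ Finset.range m, y j ^ 2) ≤ (m + 1) * C ^ 2 := by nlinarith [sq_nonneg C]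
  calc (2 : ℝ) ^ m * (∑ j ∈ Finset.range m, y j ^ 2) * (m + 1)
      ≤ 2 ^ m * ((m + 1) * C ^ 2) * (m + 1) := by gcongr
    _ = 2 ^ m * C ^ 2 * (m + 1) ^ 2 := by ring

theorem sum_sq_signedMean_two_pow_le {y : ℕ → ℝ} {C : ℝ} (hy : ∀ n, |y n| ≤ C) (m : ℕ) :
    ∑ n ∈ Finset.range (2 ^ m), signedMean y n ^ 2 ≤ 3 * C ^ 2 * 2 ^ m / (m + 1) := by
  rcases m with _ | m
  · simp [signedMean]; positivity
  induction m with
  | zero => simp [Finset.sum_range_succ, signedMean]; positivity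
  | succ m ih =>
    rw [pow_succ 2 (m + 1), mul_two, Finset.sum_range_add]
    refine (add_le_add ih (sum_sq_signedMean_block_le hy (m + 1))).trans ?_
    rw [← add_div, div_le_div_iff₀ (by positivity) (by positivity)]
    push_cast
    have h : 0 ≤ C ^ 2 * 2 ^ (m + 1) * m := by positivity
    rw [pow_succ (2 : ℝ) (m + 1)]
    linarith

theorem tendsto_log_two_atTop : Tendsto (Nat.log 2) atTop atTop :=
  tendsto_atTop.2 fun m => (eventually_ge_atTop (2 ^ m)).mono fun _ hn =>
    Nat.le_log_of_pow_le one_lt_two hn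

theorem tendsto_mean_sq_signedMean {y : ℕ → ℝ} {C : ℝ} (hy : ∀ n, |y n| ≤ C) :
    Tendsto (fun n : ℕ => (∑ k ∈ Finset.Icc 1 n, signedMean y k ^ 2) / n) atTop (𝓝 0) := by
  have hlog : Tendsto (fun n : ℕ => 6 * C ^ 2 / ((Nat.log 2 n : ℕ) : ℝ)) atTop (𝓝 0) :=
    tendsto_const_nhds.div_atTop
      (tendsto_natCast_atTop_atTop.comp tendsto_log_two_atTop)
  refine squeeze_zero' (Eventually.of_forall fun n => by positivity) ?_ hlog
  filter_upwards [eventually_ge_atTop 2] with n hn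
  have hL : 0 < Nat.log 2 n := Nat.log_pos one_lt_two hn
  have hpow : ((2 : ℝ) ^ Nat.log 2 n) ≤ n := by
    exact_mod_cast Nat.pow_log_le_self 2 (by omega)
  have hlt : n < 2 ^ (Nat.log 2 n + 1) := Nat.lt_pow_succ_log_self one_lt_two n
  have hsub : Finset.Icc 1 n ⊆ Finset.range (2 ^ (Nat.log 2 n + 1)) := by
    intro k hk
    rw [Finset.mem_Icc] at hk
    rw [Finset.mem_range]; omega
  have h1 := (Finset.sum_le_sum_of_subset_of_nonneg hsub
    fun k _ _ => sq_nonneg (signedMean y k)).trans (sum_sq_signedMean_two_pow_le hy _)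
  have hL' : (0 : ℝ) < Nat.log 2 n := by exact_mod_cast hL
  rw [div_le_iff₀ (by positivity : (0 : ℝ) < n)]
  refine h1.trans ?_
  rw [div_mul_eq_mul_div, pow_succ 2 (Nat.log 2 n)]
  push_cast
  refine div_le_div₀ (by positivity) ?_ hL' (by linarith)
  nlinarith [mul_le_mul_of_nonneg_left hpow (sq_nonneg C)]

theorem mem_densityZeroIdeal_of_indicator_le {S : Set ℕ} {f : ℕ → ℝ} {K : ℝ}
    (hf : Tendsto (fun n : ℕ => (∑ k ∈ Finset.Icc 1 n, f k) / n) atTop (𝓝 0))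
    (hS : ∀ n, S.indicator (fun _ => (1 : ℝ)) n ≤ K * f n) : S ∈ densityZeroIdeal := by
  have hK := hf.const_mul K
  rw [mul_zero] at hK
  refine squeeze_zero (fun n => ?_) (fun n => ?_) hK
  · exact div_nonneg
      (Finset.sum_nonneg fun k _ => Set.indicator_nonneg (fun _ _ => zero_le_one) k)
      (Nat.cast_nonneg n)
  · rw [← mul_div_assoc, Finset.mul_sum]
    gcongr with k
    exact hS k

theorem tendsto_mean_Icc {u : ℕ → ℝ} {l : ℝ} (hu : Tendsto u atTop (𝓝 l)) :
    Tendsto (fun n : ℕ => (∑ k ∈ Finset.Icc 1 n, u k) / n) atTop (𝓝 l) := by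
  have h := ((tendsto_add_atTop_iff_nat 1).2 hu).cesaro
  refine h.congr fun n => ?_
  rw [div_eq_inv_mul, Finset.range_eq_Ico, Finset.sum_Ico_add' u 0 n 1]
  rfl

theorem notMem_densityZeroIdeal_of_eventually {S : Set ℕ} (hS : ∀ᶠ n in atTop, n ∈ S) :
    S ∉ densityZeroIdeal := by
  intro h
  have h1 : Tendsto (S.indicator fun _ => (1 : ℝ)) atTop (𝓝 1) :=
    tendsto_const_nhds.congr' (hS.mono fun n hn => (Set.indicator_of_mem hn _).symm)
  exact zero_ne_one (tendsto_nhds_unique h (tendsto_mean_Icc h1))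

/-- Bounded sequences converging along the density zero ideal are Cesàro convergent. -/
theorem tendsto_mean_of_idealLim {x : ℕ → ℝ} {η C : ℝ} (hx : ∀ n, |x n| ≤ C)
    (hlim : IdealLim densityZeroIdeal x η) :
    Tendsto (fun n : ℕ => (∑ k ∈ Finset.Icc 1 n, x k) / n) atTop (𝓝 η) := by
  have hC : 0 ≤ C := (abs_nonneg _).trans (hx 0)
  rw [Metric.tendsto_atTop']
  intro ε hε
  have hS : Tendsto (fun n : ℕ => (∑ k ∈ Finset.Icc 1 n,
      {n : ℕ | ε / 2 < |x n - η|}.indicator (fun _ => (1 : ℝ)) k) / n) atTop (𝓝 0) :=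
    hlim (ε / 2) (half_pos hε)
  have hS' := hS.const_mul (C + |η|)
  rw [mul_zero] at hS'
  obtain ⟨N, hN⟩ := eventually_atTop.1 (hS'.eventually_lt_const (half_pos hε))
  refine ⟨N, fun n hn => ?_⟩
  have hn0 : (0 : ℝ) < n := by exact_mod_cast (Nat.zero_le N).trans_lt hn
  have hN := hN n hn.le
  rw [← mul_div_assoc, div_lt_iff₀ hn0] at hN
  rw [Real.dist_eq, div_sub' hn0.ne', abs_div, abs_of_pos hn0, div_lt_iff₀ hn0]
  have hconst : (n : ℝ) * η = ∑ k ∈ Finset.Icc 1 n, η := by simp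
  rw [hconst, ← Finset.sum_sub_distrib]
  refine (Finset.abs_sum_le_sum_abs _ _).trans_lt ?_
  have hle : ∀ k ∈ Finset.Icc 1 n, |x k - η| ≤ ε / 2 + (C + |η|) *
      {n : ℕ | ε / 2 < |x n - η|}.indicator (fun _ => (1 : ℝ)) k := by
    intro k _
    by_cases hk : ε / 2 < |x k - η|
    · rw [Set.indicator_of_mem (by exact hk)]
      linarith [abs_sub (x k) η, hx k]
    · rw [Set.indicator_of_notMem (by exact hk)]
      linarith
  refine (Finset.sum_le_sum hle).trans_lt ?_
  rw [Finset.sum_add_distrib, ← Finset.mul_sum]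
  simp only [Finset.sum_const, Nat.card_Icc, nsmul_eq_mul, Nat.add_sub_cancel]
  linarith

/-- The Cesàro matrix perturbed by signed means along the sequence `e`. -/
noncomputable def signedCesaro (e : ℕ → ℕ) (n k : ℕ) : ℝ :=
  (if k ∈ Finset.Icc 1 n then 1 / (n : ℝ) else 0) +
    ∑ j ∈ Finset.range (Nat.log 2 n), if k = e j then bitSign j n / (Nat.log 2 n + 1) else 0

theorem hasSum_signedCesaro (e : ℕ → ℕ) (x : ℕ → ℝ) (n : ℕ) :
    HasSum (fun k => signedCesaro e n k * x k)
      ((∑ k ∈ Finset.Icc 1 n, x k) / n + signedMean (x ∘ e) n) := by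
  simp only [signedCesaro, add_mul, Finset.sum_mul, signedMean, Finset.sum_div, ite_mul, zero_mul]
  refine HasSum.add ?_ (hasSum_sum fun j _ => ?_)
  · have h := hasSum_sum_of_ne_finset_zero (L := .unconditional ℕ) (s := Finset.Icc 1 n)
      (f := fun k => if k ∈ Finset.Icc 1 n then 1 / (n : ℝ) * x k else 0)
      fun k hk => if_neg hk
    convert h using 1
    refine Finset.sum_congr rfl fun k hk => ?_
    rw [if_pos hk]; ring
  · convert hasSum_ite_eq (e j) (bitSign j n / (Nat.log 2 n + 1) * x (e j)) using 1
    · funext k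
      split_ifs with h
      · rw [h]
      · rfl
    · simp only [Function.comp]; ring

theorem abs_signedCesaro_apply_ge {e : ℕ → ℕ} (he : Function.Injective e) {n j : ℕ}
    (hj : j < Nat.log 2 n) :
    1 / ((Nat.log 2 n : ℝ) + 1) - 1 / n ≤ |signedCesaro e n (e j)| := by
  have h1 : (∑ i ∈ Finset.range (Nat.log 2 n),
      if e j = e i then bitSign i n / ((Nat.log 2 n : ℝ) + 1) else 0)
      = bitSign j n / (Nat.log 2 n + 1) := by
    simp [he.eq_iff, hj]
  have h2 : |bitSign j n / ((Nat.log 2 n : ℝ) + 1)| = 1 / (Nat.log 2 n + 1) := by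
    rw [abs_div, abs_bitSign, abs_of_pos (by positivity)]
  have h3 : |if e j ∈ Finset.Icc 1 n then 1 / (n : ℝ) else 0| ≤ 1 / n := by
    split_ifs
    · rw [abs_of_nonneg (by positivity)]
    · simp
  rw [signedCesaro, h1, add_comm (ite _ _ _)]
  have h4 := abs_sub_abs_le_abs_add (bitSign j n / ((Nat.log 2 n : ℝ) + 1))
    (if e j ∈ Finset.Icc 1 n then 1 / (n : ℝ) else 0)
  linarith

theorem quarter_le_tsum_signedCesaro {e : ℕ → ℕ} (he : Function.Injective e) {E : Set ℕ}
    (heE : ∀ j, e j ∈ E) {n : ℕ} (hn : 8 ≤ n) :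
    1 / 4 ≤ ∑' k, E.indicator (fun j => |signedCesaro e n j|) k := by
  have hsum : Summable (E.indicator fun j => |signedCesaro e n j|) := by
    have h := (hasSum_signedCesaro e (fun _ => 1) n).summable
    simp only [mul_one] at h
    exact h.abs.indicator E
  have hL : 3 ≤ Nat.log 2 n := Nat.le_log_of_pow_le one_lt_two (by omega)
  have hpow : 2 ^ Nat.log 2 n ≤ n := Nat.pow_log_le_self 2 (by omega)
  have h2 : 2 * Nat.log 2 n ≤ n := by
    refine le_trans ?_ hpow
    generalize Nat.log 2 n = L at hL
    induction L, hL using Nat.le_induction with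
    | base => norm_num
    | succ L hL ih => rw [pow_succ]; omega
  refine le_trans ?_ (hsum.sum_le_tsum ((Finset.range (Nat.log 2 n)).image e)
    fun k _ => Set.indicator_nonneg (fun _ _ => abs_nonneg _) k)
  rw [Finset.sum_image he.injOn]
  have hterm : ∀ j ∈ Finset.range (Nat.log 2 n), 1 / ((Nat.log 2 n : ℝ) + 1) - 1 / n
      ≤ E.indicator (fun j => |signedCesaro e n j|) (e j) := fun j hj => by
    rw [Set.indicator_of_mem (heE j)]
    exact abs_signedCesaro_apply_ge he (Finset.mem_range.1 hj)
  refine le_trans ?_ (Finset.sum_le_sum hterm)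
  rw [Finset.sum_const, Finset.card_range, nsmul_eq_mul]
  have hL' : (3 : ℝ) ≤ Nat.log 2 n := by exact_mod_cast hL
  have h2' : 2 * (Nat.log 2 n : ℝ) ≤ n := by exact_mod_cast h2
  have hn' : (0 : ℝ) < n := by linarith
  have h3 : 3 / 4 ≤ (Nat.log 2 n : ℝ) / (Nat.log 2 n + 1) := by
    rw [le_div_iff₀ (by linarith)]; linarith
  have h4 : (Nat.log 2 n : ℝ) / n ≤ 1 / 2 := by
    rw [div_le_iff₀ hn']; linarith
  rw [mul_sub, mul_one_div, mul_one_div]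
  linarith

theorem regular_signedCesaro {I : Set (Set ℕ)} (hIZ : I ⊆ densityZeroIdeal) (e : ℕ → ℕ) :
    IJRegular I densityZeroIdeal (signedCesaro e) := by
  rintro x ⟨C, hC⟩ η hη
  have hC0 : 0 ≤ C := (abs_nonneg _).trans (hC 0)
  have hmul : ∀ n, matMul (signedCesaro e) x n
      = (∑ k ∈ Finset.Icc 1 n, x k) / n + signedMean (x ∘ e) n :=
    fun n => (hasSum_signedCesaro e x n).tsum_eq
  have hy : ∀ n, |(x ∘ e) n| ≤ C := fun n => hC _
  refine ⟨fun n => (hasSum_signedCesaro e x n).summable, ⟨C + C, fun n => ?_⟩, fun ε hε => ?_⟩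
  · rw [hmul]
    refine (abs_add_le _ _).trans (add_le_add ?_ (abs_signedMean_le hy n))
    rw [abs_div, Nat.abs_cast]
    refine div_le_of_le_mul₀ (Nat.cast_nonneg n) hC0 ?_
    refine (Finset.abs_sum_le_sum_abs _ _).trans
      ((Finset.sum_le_sum fun k _ => hC k).trans_eq ?_)
    simp [mul_comm]
  · have hu := tendsto_mean_of_idealLim hC fun ε hε => hIZ (hη ε hε)
    have hu2 := (hu.sub_const η).pow 2
    rw [sub_self, zero_pow two_ne_zero] at hu2
    have hsum := (tendsto_mean_Icc hu2).add (tendsto_mean_sq_signedMean hy)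
    simp only [← add_div, ← Finset.sum_add_distrib, add_zero] at hsum
    refine mem_densityZeroIdeal_of_indicator_le (K := 2 / ε ^ 2) hsum fun n => ?_
    by_cases hn : ε < |matMul (signedCesaro e) x n - η|
    · rw [Set.indicator_of_mem (by exact hn), div_mul_eq_mul_div, le_div_iff₀ (by positivity),
        one_mul]
      rw [hmul, add_sub_right_comm] at hn
      have h := pow_le_pow_left₀ hε.le hn.le 2
      rw [sq_abs] at h
      exact h.trans add_sq_le
    · rw [Set.indicator_of_notMem (by exact hn)]
      positivity

/-- If `I` is an admissible ideal with `Fin ⊊ I ⊆ Z`, where `Z` is the ideal of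
asymptotic density zero sets, then there is an `(I, Z)`-regular matrix `A`
failing condition (T3): for some `E ∈ I` the sequence `(∑_{k ∈ E} |a n k|)ₙ`
does not `Z`-converge to `0`. -/
theorem exists_regular_not_T3 (I : Set (Set ℕ)) (hI : IsAdmissibleIdeal I)
    (hFin : {E : Set ℕ | E.Finite} ⊂ I) (hIZ : I ⊆ densityZeroIdeal) :
    ∃ a : ℕ → ℕ → ℝ, IJRegular I densityZeroIdeal a ∧
      ∃ E ∈ I, ¬ IdealLim densityZeroIdeal
        (fun n => ∑' k, E.indicator (fun j => |a n j|) k) 0 := by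
  obtain ⟨E, hEI, hE⟩ := Set.exists_of_ssubset hFin
  let e := Set.Infinite.natEmbedding E hE
  refine ⟨signedCesaro fun j => e j, regular_signedCesaro hIZ _, E, hEI, fun h => ?_⟩
  refine notMem_densityZeroIdeal_of_eventually ?_ (h (1 / 8) (by norm_num))
  filter_upwards [eventually_ge_atTop 8] with n hn
  have h4 := quarter_le_tsum_signedCesaro (Subtype.val_injective.comp e.injective)
    (fun j => (e j).2) hn
  change 1 / 8 < |_ - 0|
  rw [sub_zero]
  exact (lt_of_lt_of_le (by norm_num) h4).trans_le (le_abs_self _)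
end

section
/- Let I, J be admissible ideals on ℕ and let A = (a_{n,k}) be an infinite real matrix with a_{n,k} ≥ 0 for all n, k, whose rows are summable (∑_k a_{n,k} < ∞ for each n). Then A satisfies both (T2) J-lim_n ∑_k a_{n,k} = 1 and (T3) J-lim_n ∑_{k∈E} a_{n,k} = 0 for every E ∈ I, if and only if A satisfies (T4): J-lim_n ∑_{k∈F} a_{n,k} = 1 for every F in the dual filter I* = {F ⊆ ℕ : ℕ∖F ∈ I}. -/
open Filter Topology

/-- Ideal limits are compatible with subtraction. -/
theorem IdealLim.sub {J : Set (Set ℕ)} (hJ : IsAdmissibleIdeal J) {x y : ℕ → ℝ} {η ζ : ℝ}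
    (hx : IdealLim J x η) (hy : IdealLim J y ζ) :
    IdealLim J (fun n => x n - y n) (η - ζ) := by
  intro ε hε
  refine hJ.1 _ (hJ.2.1 _ (hx (ε / 2) (by positivity)) _ (hy (ε / 2) (by positivity))) _ ?_
  intro n hn
  simp only [Set.mem_union, Set.mem_ofPred_eq] at hn ⊢
  by_contra! h
  have := abs_sub (x n - η) (y n - ζ)
  rw [sub_sub_sub_comm] at hn
  linarith

/-- A summable series over `E` is the full series minus the series over `Eᶜ`. -/
theorem Summable.tsum_indicator_eq_sub_compl {f : ℕ → ℝ} (hf : Summable f) (E : Set ℕ) :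
    ∑' k, E.indicator f k = ∑' k, f k - ∑' k, Eᶜ.indicator f k := by
  rw [← hf.tsum_sub (hf.indicator Eᶜ)]
  refine tsum_congr fun k => ?_
  by_cases hk : k ∈ E <;> simp [hk]

/-- For a nonnegative matrix `A` with summable rows and admissible ideals
`I, J`, conditions (T2) and (T3) hold together iff condition (T4) holds:
`J-lim_n ∑_{k ∈ F} a n k = 1` for every `F` in the dual filter of `I`. -/
theorem T2_T3_iff_T4 (I J : Set (Set ℕ))
    (hI : IsAdmissibleIdeal I) (hJ : IsAdmissibleIdeal J)
    (a : ℕ → ℕ → ℝ) (ha : ∀ n k, 0 ≤ a n k) (hrow : ∀ n, Summable (a n)) :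
    (IdealLim J (fun n => ∑' k, a n k) 1 ∧
      ∀ E ∈ I, IdealLim J (fun n => ∑' k, E.indicator (a n) k) 0) ↔
      (∀ F : Set ℕ, Fᶜ ∈ I →
        IdealLim J (fun n => ∑' k, F.indicator (a n) k) 1) := by
  constructor
  · rintro ⟨h2, h3⟩ F hF
    have h := h2.sub hJ (h3 _ hF)
    simp only [← (hrow _).tsum_indicator_eq_sub_compl, sub_zero] at h
    exact h
  · intro h4
    have h2 : IdealLim J (fun n => ∑' k, a n k) 1 := by
      simpa using h4 Set.univ (by simpa using hI.2.2.1 ∅ Set.finite_empty)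
    refine ⟨h2, fun E hE => ?_⟩
    have h := h2.sub hJ (h4 Eᶜ (by rwa [compl_compl]))
    simp only [← (hrow _).tsum_indicator_eq_sub_compl, sub_self] at h
    exact h
end

section
/- Let g, h : ℕ → [0,∞) be functions with g(n) → ∞, h(n) → ∞, n/g(n) not converging to 0, and n/h(n) not converging to 0, and assume limsup_{n→∞} n/g(n) < ∞ and limsup_{n→∞} g(⌊αn⌋)/h(n) < ∞ for every real α > 1. Let σ be a permutation of ℕ and let σ̂ be the sequence σ̂_n = n/σ⁻¹(n). Then σ(E) ∈ Z_h for every E ∈ Z_g if and only if 0 is not a Z_h-limit point of σ̂, i.e., there is no subsequence (σ̂_{n_k}) with lim_k σ̂_{n_k} = 0 and {n_k : k ∈ ℕ} ∉ Z_h. -/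
open Filter Topology

/-- The simple density ideal `Z_g` generated by `g`: sets `S` whose counting
function `|S ∩ [1, n]|` satisfies `limsup_n |S ∩ [1, n]| / g n = 0`
(equivalently, it tends to `0`, the terms being nonnegative). -/
def simpleDensityIdeal (g : ℕ → ℝ) : Set (Set ℕ) :=
  {S : Set ℕ | Tendsto
    (fun n : ℕ => (∑ k ∈ Finset.Icc 1 n, S.indicator (fun _ => (1 : ℝ)) k) / g n)
    atTop (𝓝 0)}

open Classical in
theorem sum_Icc_indicator_eq_ncard (S : Set ℕ) (n : ℕ) :
    ∑ k ∈ Finset.Icc 1 n, S.indicator (fun _ => (1 : ℝ)) k = ((S ∩ Set.Icc 1 n).ncard : ℝ) := by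
  have hset : S ∩ Set.Icc 1 n = ((Finset.Icc 1 n).filter (· ∈ S) : Finset ℕ) := by
    ext k
    simp only [Set.mem_inter_iff, Set.mem_Icc, Finset.coe_filter, Finset.mem_Icc]
    exact and_comm
  rw [hset, Set.ncard_coe_finset, Finset.card_filter]
  push_cast
  exact Finset.sum_congr rfl fun k _ => by simp [Set.indicator_apply]

theorem mem_simpleDensityIdeal_iff {h : ℕ → ℝ} (hh : Tendsto h atTop atTop) {S : Set ℕ} :
    S ∈ simpleDensityIdeal h ↔
      ∀ ε : ℝ, 0 < ε → ∀ᶠ n in atTop, ((S ∩ Set.Icc 1 n).ncard : ℝ) ≤ ε * h n := by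
  have hpos := hh.eventually_gt_atTop 0
  simp only [simpleDensityIdeal, Set.mem_ofPred_eq, sum_Icc_indicator_eq_ncard]
  constructor
  · intro H ε hε
    filter_upwards [H.eventually_le_const hε, hpos] with n hn hp
    rwa [div_le_iff₀ hp] at hn
  · intro H
    rw [Metric.tendsto_nhds]
    intro ε hε
    filter_upwards [H (ε / 2) (half_pos hε), hpos] with n hn hp
    rw [Real.dist_0_eq_abs, abs_of_nonneg (by positivity), div_lt_iff₀ hp]
    nlinarith

theorem simpleDensityIdeal_mono {h : ℕ → ℝ} (hh : Tendsto h atTop atTop) {S T : Set ℕ}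
    (hST : S ⊆ T) (hT : T ∈ simpleDensityIdeal h) : S ∈ simpleDensityIdeal h := by
  rw [mem_simpleDensityIdeal_iff hh] at hT ⊢
  intro ε hε
  filter_upwards [hT ε hε] with n hn
  refine le_trans ?_ hn
  exact_mod_cast Set.ncard_le_ncard (Set.inter_subset_inter_left _ hST)
    ((Set.finite_Icc 1 n).inter_of_right T)

theorem simpleDensityIdeal_union {h : ℕ → ℝ} (hh : Tendsto h atTop atTop) {S T : Set ℕ}
    (hS : S ∈ simpleDensityIdeal h) (hT : T ∈ simpleDensityIdeal h) :
    S ∪ T ∈ simpleDensityIdeal h := by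
  rw [mem_simpleDensityIdeal_iff hh] at hS hT ⊢
  intro ε hε
  filter_upwards [hS (ε / 2) (half_pos hε), hT (ε / 2) (half_pos hε)] with n hSn hTn
  have hle : (((S ∪ T) ∩ Set.Icc 1 n).ncard : ℝ) ≤
      (S ∩ Set.Icc 1 n).ncard + (T ∩ Set.Icc 1 n).ncard := by
    rw [Set.union_inter_distrib_right]
    exact_mod_cast Set.ncard_union_le _ _
  linarith

theorem finite_mem_simpleDensityIdeal {h : ℕ → ℝ} (hh : Tendsto h atTop atTop) {S : Set ℕ}
    (hS : S.Finite) : S ∈ simpleDensityIdeal h := by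
  rw [mem_simpleDensityIdeal_iff hh]
  intro ε hε
  filter_upwards [(hh.const_mul_atTop hε).eventually_ge_atTop (S.ncard : ℝ)] with n hn
  refine le_trans ?_ hn
  exact_mod_cast Set.ncard_le_ncard Set.inter_subset_left hS

/-- The ideal `Z_h` is a P-ideal. The pseudo-union of the monotone sequence `B` is built as a
diagonal set `{m | m ∈ B (J m)}`. -/
theorem exists_diagonal_mem_simpleDensityIdeal {h : ℕ → ℝ} (hh : Tendsto h atTop atTop)
    {B : ℕ → Set ℕ} (hBmono : Monotone B) (hB : ∀ j, B j ∈ simpleDensityIdeal h) :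
    ∃ J : ℕ → ℕ, Tendsto J atTop atTop ∧ {m | m ∈ B (J m)} ∈ simpleDensityIdeal h := by
  classical
  let P : ℕ → ℕ → Prop := fun n j =>
    ∀ m ≥ n, ((B j ∩ Set.Icc 1 m).ncard : ℝ) ≤ 1 / ((j : ℝ) + 1) * h m
  let J : ℕ → ℕ := fun n => Nat.findGreatest (P n) n
  have hJmono : Monotone J := fun a b hab =>
    Nat.findGreatest_mono (fun j hj m hm => hj m (hab.trans hm)) hab
  have hJge : ∀ j, ∀ᶠ n in atTop, j ≤ J n := by
    intro j
    obtain ⟨N, hN⟩ := eventually_atTop.1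
      ((mem_simpleDensityIdeal_iff hh).1 (hB j) (1 / ((j : ℝ) + 1)) (by positivity))
    filter_upwards [eventually_ge_atTop N, eventually_ge_atTop j] with n hnN hnj
    exact Nat.le_findGreatest hnj fun m hm => hN m (hnN.trans hm)
  refine ⟨J, tendsto_atTop.2 hJge, ?_⟩
  rw [mem_simpleDensityIdeal_iff hh]
  intro ε hε
  obtain ⟨j, hj⟩ := exists_nat_one_div_lt hε
  filter_upwards [hJge (j + 1), hh.eventually_gt_atTop 0] with n hn hpos
  have hP : P n (J n) := Nat.findGreatest_of_ne_zero rfl (by omega)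
  have hsub : {m | m ∈ B (J m)} ∩ Set.Icc 1 n ⊆ B (J n) ∩ Set.Icc 1 n :=
    fun m hm => ⟨hBmono (hJmono hm.2.2) hm.1, hm.2⟩
  have hcard : (({m | m ∈ B (J m)} ∩ Set.Icc 1 n).ncard : ℝ) ≤ (B (J n) ∩ Set.Icc 1 n).ncard := by
    exact_mod_cast Set.ncard_le_ncard hsub ((Set.finite_Icc 1 n).inter_of_right _)
  have hJn : (1 : ℝ) / ((J n : ℝ) + 1) ≤ 1 / ((j : ℝ) + 1) := by
    apply one_div_le_one_div_of_le (by positivity)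
    have : (j : ℝ) ≤ J n := by exact_mod_cast (by omega : j ≤ J n)
    linarith
  calc _ ≤ _ := hcard
    _ ≤ 1 / ((J n : ℝ) + 1) * h n := hP n le_rfl
    _ ≤ ε * h n := by
      apply mul_le_mul_of_nonneg_right (hJn.trans hj.le) hpos.le

/-- The part of `σ '' E` on which `σ⁻¹ m ≤ a * m` is small for `Z_h`. -/
theorem image_inter_le_mul_mem_simpleDensityIdeal {g h : ℕ → ℝ}
    (hg : Tendsto g atTop atTop) (hh : Tendsto h atTop atTop) (σ : Equiv.Perm ℕ) {E : Set ℕ}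
    (hE : E ∈ simpleDensityIdeal g) {a : ℕ} (ha : 0 < a) {C : ℝ}
    (hC : ∀ᶠ n : ℕ in atTop, g (a * n) / h n ≤ C) :
    {m | σ.symm m ∈ E ∧ σ.symm m ≤ a * m} ∈ simpleDensityIdeal h := by
  rw [mem_simpleDensityIdeal_iff hh]
  intro ε hε
  have hC' : 0 < max C 1 := by positivity
  have hEn := (mem_simpleDensityIdeal_iff hg).1 hE (ε / 2 / max C 1) (by positivity)
  have hmul : Tendsto (fun n : ℕ => a * n) atTop atTop := tendsto_id.const_mul_atTop' ha
  filter_upwards [hmul.eventually hEn, hC, hh.eventually_gt_atTop 0,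
    (hh.const_mul_atTop (half_pos hε)).eventually_ge_atTop 1] with n hn hCn hpos hone
  have hcard : (({m | σ.symm m ∈ E ∧ σ.symm m ≤ a * m} ∩ Set.Icc 1 n).ncard : ℝ) ≤
      (E ∩ Set.Icc 1 (a * n)).ncard + 1 := by
    have hmaps : ∀ m ∈ {m | σ.symm m ∈ E ∧ σ.symm m ≤ a * m} ∩ Set.Icc 1 n,
        σ.symm m ∈ insert 0 (E ∩ Set.Icc 1 (a * n)) := by
      rintro m ⟨⟨hmE, hma⟩, -, hmn⟩
      rcases Nat.eq_zero_or_pos (σ.symm m) with h0 | h0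
      · exact Or.inl h0
      · exact Or.inr ⟨hmE, h0, hma.trans (Nat.mul_le_mul_left a hmn)⟩
    exact_mod_cast (Set.ncard_le_ncard_of_injOn _ hmaps σ.symm.injective.injOn
      (((Set.finite_Icc 1 (a * n)).inter_of_right E).insert 0)).trans (Set.ncard_insert_le _ _)
  rw [div_le_iff₀ hpos] at hCn
  have hgn : g (a * n) ≤ max C 1 * h n :=
    hCn.trans (mul_le_mul_of_nonneg_right (le_max_left _ _) hpos.le)
  have hbound : ε / 2 / max C 1 * g (a * n) ≤ ε / 2 * h n := by
    calc _ ≤ ε / 2 / max C 1 * (max C 1 * h n) := by gcongr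
      _ = ε / 2 * h n := by field_simp
  linarith

theorem preimage_mem_simpleDensityIdeal {g : ℕ → ℝ} (hg : Tendsto g atTop atTop)
    (hbd : ∃ C : ℝ, ∀ᶠ n : ℕ in atTop, (n : ℝ) / g n ≤ C) (σ : Equiv.Perm ℕ) {u : ℕ → ℕ}
    (hlim : Tendsto (fun k => ((u k : ℝ) / (σ.symm (u k) : ℝ))) atTop (𝓝 0)) :
    Set.range (fun k => σ.symm (u k)) ∈ simpleDensityIdeal g := by
  rw [mem_simpleDensityIdeal_iff hg]
  intro ε hε
  obtain ⟨C, hC⟩ := hbd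
  have hC' : 0 < max C 1 := by positivity
  set δ := ε / 2 / max C 1 with hδ
  have hδpos : 0 < δ := by positivity
  obtain ⟨K, hK⟩ := eventually_atTop.1 (hlim.eventually_le_const hδpos)
  filter_upwards [hC, hg.eventually_gt_atTop 0,
    (hg.const_mul_atTop (half_pos hε)).eventually_ge_atTop ((K : ℝ) + 1)] with n hCn hpos hKn
  have hsub : Set.range (fun k => σ.symm (u k)) ∩ Set.Icc 1 n ⊆
      ((Finset.range K).image (fun k => σ.symm (u k)) ∪
        (Finset.range (⌊δ * n⌋₊ + 1)).image σ.symm : Finset ℕ) := by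
    rintro _ ⟨⟨k, rfl⟩, h1, hn⟩
    simp only at h1 hn
    simp only [Finset.coe_union, Finset.coe_image, Finset.coe_range]
    rcases lt_or_ge k K with hk | hk
    · exact Or.inl ⟨k, hk, rfl⟩
    · refine Or.inr ⟨u k, ?_, rfl⟩
      have hpos' : (0 : ℝ) < σ.symm (u k) := by exact_mod_cast h1
      have huk := hK k hk
      rw [div_le_iff₀ hpos'] at huk
      refine Nat.lt_succ_of_le (Nat.le_floor (huk.trans ?_))
      gcongr
  have hcard : ((Set.range (fun k => σ.symm (u k)) ∩ Set.Icc 1 n).ncard : ℝ) ≤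
      K + (⌊δ * n⌋₊ + 1) := by
    have hle := Set.ncard_le_ncard hsub (Finset.finite_toSet _)
    rw [Set.ncard_coe_finset] at hle
    have h1 := Finset.card_union_le ((Finset.range K).image (fun k => σ.symm (u k)))
      ((Finset.range (⌊δ * n⌋₊ + 1)).image σ.symm)
    have h2 := Finset.card_image_le (s := Finset.range K) (f := fun k => σ.symm (u k))
    have h3 := Finset.card_image_le (s := Finset.range (⌊δ * n⌋₊ + 1)) (f := σ.symm)
    rw [Finset.card_range] at h2 h3
    exact_mod_cast (by omega :
      (Set.range (fun k => σ.symm (u k)) ∩ Set.Icc 1 n).ncard ≤ K + (⌊δ * n⌋₊ + 1))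
  have hfloor : (⌊δ * n⌋₊ : ℝ) ≤ δ * n := Nat.floor_le (by positivity)
  rw [div_le_iff₀ hpos] at hCn
  have hn : (n : ℝ) ≤ max C 1 * g n :=
    hCn.trans (mul_le_mul_of_nonneg_right (le_max_left _ _) hpos.le)
  have hbound : δ * n ≤ ε / 2 * g n := by
    calc _ ≤ δ * (max C 1 * g n) := by gcongr
      _ = ε / 2 * g n := by rw [hδ]; field_simp
  linarith

/-- For simple density ideals `Z_g, Z_h` with `limsup n / g n < ∞` and
`limsup g(⌊α n⌋) / h n < ∞` for every `α > 1`, a permutation `σ` maps `Z_g`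
into `Z_h` iff `0` is not a `Z_h`-limit point of the sequence
`σ̂ n = n / σ⁻¹ n`. -/
theorem perm_simple_density_iff_limit_point (g h : ℕ → ℝ)
    (hg0 : ∀ n, 0 ≤ g n) (hh0 : ∀ n, 0 ≤ h n)
    (hg : Tendsto g atTop atTop) (hh : Tendsto h atTop atTop)
    (hng : ¬ Tendsto (fun n : ℕ => (n : ℝ) / g n) atTop (𝓝 0))
    (hnh : ¬ Tendsto (fun n : ℕ => (n : ℝ) / h n) atTop (𝓝 0))
    (hbd : ∃ C : ℝ, ∀ᶠ n : ℕ in atTop, (n : ℝ) / g n ≤ C)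
    (hgh : ∀ α : ℝ, 1 < α → ∃ C : ℝ, ∀ᶠ n : ℕ in atTop,
      g ⌊α * (n : ℝ)⌋₊ / h n ≤ C)
    (σ : Equiv.Perm ℕ) :
    (∀ E ∈ simpleDensityIdeal g, (fun n => σ n) '' E ∈ simpleDensityIdeal h) ↔
      ¬ ∃ nk : ℕ → ℕ, StrictMono nk ∧
          Tendsto (fun k => ((nk k : ℝ) / (σ.symm (nk k) : ℝ))) atTop (𝓝 0) ∧
          {m : ℕ | ∃ k, nk k = m} ∉ simpleDensityIdeal h := by
  constructor
  · rintro H ⟨u, -, hlim, hu⟩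
    apply hu
    have himage := H _ (preimage_mem_simpleDensityIdeal hg hbd σ hlim)
    rw [← Set.range_comp] at himage
    simpa [Function.comp_def, Set.range] using himage
  · intro H E hE
    by_contra hF
    apply H
    let B : ℕ → Set ℕ := fun j => {m | σ.symm m ∈ E ∧ σ.symm m ≤ (j + 2) * m}
    have hBmono : Monotone B := fun i j hij m hm =>
      ⟨hm.1, hm.2.trans (Nat.mul_le_mul_right m (by omega))⟩
    have hB : ∀ j, B j ∈ simpleDensityIdeal h := by
      intro j
      obtain ⟨C, hC⟩ := hgh ((j + 2 : ℕ) : ℝ) (by exact_mod_cast (by omega : 1 < j + 2))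
      refine image_inter_le_mul_mem_simpleDensityIdeal hg hh σ hE (by omega) (C := C) ?_
      filter_upwards [hC] with n hn
      rwa [← Nat.cast_mul, Nat.floor_natCast] at hn
    obtain ⟨J, hJ, hA⟩ := exists_diagonal_mem_simpleDensityIdeal hh hBmono hB
    let D : Set ℕ := {m | σ.symm m ∈ E ∧ m ∉ B (J m)}
    have hD : D ∉ simpleDensityIdeal h := by
      intro hD
      refine hF (simpleDensityIdeal_mono hh ?_ (simpleDensityIdeal_union hh hA hD))
      rintro _ ⟨k, hk, rfl⟩
      by_cases hm : σ k ∈ B (J (σ k))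
      · exact Or.inl hm
      · exact Or.inr ⟨by simpa using hk, hm⟩
    have hDinf : {m | m ∈ D}.Infinite := fun hfin =>
      hD (finite_mem_simpleDensityIdeal hh hfin)
    have hmono := Nat.nth_strictMono hDinf
    refine ⟨Nat.nth (· ∈ D), hmono, ?_, ?_⟩
    · rw [Metric.tendsto_nhds]
      intro ε hε
      obtain ⟨j, hj⟩ := exists_nat_one_div_lt hε
      filter_upwards [(hJ.comp hmono.tendsto_atTop).eventually_ge_atTop j] with k hk
      obtain ⟨hmE, hmB⟩ := Nat.nth_mem_of_infinite hDinf k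
      set m := Nat.nth (· ∈ D) k
      have hlt : (j + 1) * m < σ.symm m := by
        refine lt_of_le_of_lt (Nat.mul_le_mul_right m ?_) (not_le.1 fun hle => hmB ⟨hmE, hle⟩)
        have hjm : j ≤ J m := hk
        omega
      have hltR : ((j : ℝ) + 1) * m < σ.symm m := by exact_mod_cast hlt
      have hpos : (0 : ℝ) < σ.symm m := lt_of_le_of_lt (by positivity) hltR
      rw [Real.dist_0_eq_abs, abs_of_nonneg (by positivity)]
      refine lt_of_le_of_lt ?_ hj
      rw [div_le_div_iff₀ hpos (by positivity)]
      linarith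
    · have hrange : {m : ℕ | ∃ k, Nat.nth (· ∈ D) k = m} = D :=
        Nat.range_nth_of_infinite hDinf
      rwa [hrange]
end
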